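/- arXiv:1509.01971 — 2 statements merged into one kernel-verified Lean document; each statement's English description precedes it below -/
import Mathlib

section
/- In the Lie algebra 𝔤 = (0,0,0,12,13−24,23+14,0), every closed 4-form φ satisfies φ₃₄₅₆ = 0; consequently, for the quotient 𝔥 = 𝔤/ℝe₇ with f_i = π(e_i), the 4-form σ = π_*(φ − π*ψ₋ ∧ η) (for any 1-form η with ι_{e₇}η ≠ 0, where ψ₋ = π_*(−ι_{e₇}φ)) vanishes on the subspace W = Span(f₃,f₄,f₅,f₆). -/
/- STATEMENT 14: In 𝔤 = (0,0,0,12,13−24,23+14,0) every closed 4-form φ has φ₃₄₅₆ = 0;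
consequently for 𝔥 = 𝔤/ℝe₇ (f_i = π(e_i)), any 1-form η with ι_{e₇}η ≠ 0, and
ψ₋ = π_*(−ι_{e₇}φ), the 4-form σ = π_*(φ − π*ψ₋ ∧ η) vanishes on
W = Span(f₃,f₄,f₅,f₆).  Forms on 𝔥 are identified with forms on 𝔤 via the pullback
π* (`piStar`).  (0-based indices below; W = {w | w₀ = w₁ = 0}.) -/

noncomputable section

open ExteriorAlgebra

abbrev W7 : Type := Fin 7 → ℝ
abbrev W6 : Type := Fin 6 → ℝ

def dualize7 (x : Fin 7 → ℝ) : Module.Dual ℝ W7 := ∑ i : Fin 7, x i • LinearMap.proj i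
def dualize6 (x : Fin 6 → ℝ) : Module.Dual ℝ W6 := ∑ i : Fin 6, x i • LinearMap.proj i

def ctr7 (x : Fin 7 → ℝ) : ExteriorAlgebra ℝ W7 →ₗ[ℝ] ExteriorAlgebra ℝ W7 :=
  CliffordAlgebra.contractLeft (dualize7 x)
def ctr6 (x : Fin 6 → ℝ) : ExteriorAlgebra ℝ W6 →ₗ[ℝ] ExteriorAlgebra ℝ W6 :=
  CliffordAlgebra.contractLeft (dualize6 x)

def ev (i : Fin 7) : ExteriorAlgebra ℝ W7 := ExteriorAlgebra.ι ℝ (Pi.single i 1)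

/-- the differentials of 𝔤 = (0,0,0,12,13−24,23+14,0) -/
def d1 : Fin 7 → ExteriorAlgebra ℝ W7 :=
  ![0, 0, 0, ev 0 * ev 1, ev 0 * ev 2 - ev 1 * ev 3, ev 1 * ev 2 + ev 0 * ev 3, 0]

def phi4 (c : Fin 7 → Fin 7 → Fin 7 → Fin 7 → ℝ) : ExteriorAlgebra ℝ W7 :=
  ∑ i : Fin 7, ∑ j : Fin 7, ∑ k : Fin 7, ∑ l : Fin 7,
    if i < j ∧ j < k ∧ k < l then c i j k l • (ev i * ev j * ev k * ev l) else 0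

def dPhi4 (c : Fin 7 → Fin 7 → Fin 7 → Fin 7 → ℝ) : ExteriorAlgebra ℝ W7 :=
  ∑ i : Fin 7, ∑ j : Fin 7, ∑ k : Fin 7, ∑ l : Fin 7,
    if i < j ∧ j < k ∧ k < l then
      c i j k l • (d1 i * ev j * ev k * ev l - ev i * d1 j * ev k * ev l
        + ev i * ev j * d1 k * ev l - ev i * ev j * ev k * d1 l)
    else 0

/-- pullback π* : Λ•𝔥* → Λ•𝔤* for 𝔥 = 𝔤/ℝe₇: on covector coordinates,
(a₀,…,a₅) ↦ (a₀,…,a₅,0) -/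
def piStar : ExteriorAlgebra ℝ W6 →ₐ[ℝ] ExteriorAlgebra ℝ W7 :=
  ExteriorAlgebra.map
    (Matrix.toLin' (Matrix.of fun (i : Fin 7) (j : Fin 6) =>
      if (i : ℕ) = (j : ℕ) then (1:ℝ) else 0))

theorem ev_sq (i : Fin 7) : ev i * ev i = 0 := ExteriorAlgebra.ι_sq_zero _
theorem ev_sq' (i : Fin 7) (x) : ev i * (ev i * x) = 0 := by rw [← mul_assoc, ev_sq, zero_mul]
theorem ev_swap {i j : Fin 7} (_h : i < j) : ev j * ev i = -(ev i * ev j) :=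
  eq_neg_of_add_eq_zero_left (ExteriorAlgebra.ι_add_mul_swap _ _)
theorem ev_swap' {i j : Fin 7} (h : i < j) (x) : ev j * (ev i * x) = -(ev i * (ev j * x)) := by
  rw [← mul_assoc, ev_swap h, neg_mul, mul_assoc]

theorem map_contract {M N : Type*} [AddCommGroup M] [Module ℝ M] [AddCommGroup N] [Module ℝ N]
    (f : M →ₗ[ℝ] N) (d : Module.Dual ℝ N) (x : ExteriorAlgebra ℝ M) :
    CliffordAlgebra.contractLeft d (ExteriorAlgebra.map f x)
      = ExteriorAlgebra.map f (CliffordAlgebra.contractLeft (d ∘ₗ f) x) := by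
  induction x using CliffordAlgebra.left_induction with
  | algebraMap r => 
    rw [AlgHom.commutes, CliffordAlgebra.contractLeft_algebraMap]
    erw [CliffordAlgebra.contractLeft_algebraMap]; simp
  | add x y hx hy => simp only [map_add, hx, hy]
  | ι_mul x m hx =>
    have this : ExteriorAlgebra.map f (CliffordAlgebra.ι _ m) = ExteriorAlgebra.ι ℝ (f m) :=
      ExteriorAlgebra.map_apply_ι _ _
    rw [map_mul (ExteriorAlgebra.map f), CliffordAlgebra.contractLeft_ι_mul, map_sub, map_mul (ExteriorAlgebra.map f), map_smul,
      ← hx]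
    have : ExteriorAlgebra.map f (CliffordAlgebra.ι _ m) = ExteriorAlgebra.ι ℝ (f m) :=
      ExteriorAlgebra.map_apply_ι _ _
    rw [this]
    exact CliffordAlgebra.contractLeft_ι_mul _ _ _

theorem contract_pow {M : Type*} [AddCommGroup M] [Module ℝ M] (d : Module.Dual ℝ M) (n : ℕ) :
    ∀ x ∈ (LinearMap.range (ExteriorAlgebra.ι ℝ (M := M))) ^ (n+1),
      (CliffordAlgebra.contractLeft d x : ExteriorAlgebra ℝ M) ∈
        (LinearMap.range (ExteriorAlgebra.ι ℝ (M := M))) ^ n := by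
  induction n with
  | zero =>
    intro x hx
    rw [zero_add, pow_one] at hx
    obtain ⟨v, rfl⟩ := hx
    rw [pow_zero, Submodule.mem_one]
    exact ⟨d v, (CliffordAlgebra.contractLeft_ι (Q := 0) d v).symm⟩
  | succ n ih =>
    intro x hx
    rw [pow_succ'] at hx
    induction hx using Submodule.mul_induction_on' with
    | mem_mul_mem v hv y hy =>
      obtain ⟨v, rfl⟩ := hv
      have := CliffordAlgebra.contractLeft_ι_mul (Q := (0 : QuadraticForm ℝ M)) d v y
      erw [this]
      refine Submodule.sub_mem _ (Submodule.smul_mem _ _ hy) ?_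
      rw [pow_succ']
      exact Submodule.mul_mem_mul ⟨v, rfl⟩ (ih y hy)
    | add x _ y _ hx hy => rw [map_add]; exact Submodule.add_mem _ hx hy

def proj (s : Finset (Fin 7)) : W7 →ₗ[ℝ] W7 :=
  LinearMap.pi fun i => if i ∈ s then 0 else LinearMap.proj i

theorem map_proj_ev (s : Finset (Fin 7)) (i : Fin 7) :
    ExteriorAlgebra.map (proj s) (ev i) = if i ∈ s then 0 else ev i := by
  have h : proj s (Pi.single i 1) = if i ∈ s then 0 else Pi.single i 1 := by
    ext j
    by_cases hij : j = i
    · subst hij; by_cases hs : j ∈ s <;> simp [proj, hs]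
    · by_cases hs : j ∈ s <;> by_cases hs' : i ∈ s <;> simp [proj, hs, hs', hij]
  rw [ev, ExteriorAlgebra.map_apply_ι, h]
  split_ifs <;> simp

theorem ctr7_ev_mul (i j : Fin 7) (x) :
    ctr7 (Pi.single i 1) (ev j * x) = (if i = j then 1 else 0 : ℝ) • x - ev j * ctr7 (Pi.single i 1) x := by
  have := CliffordAlgebra.contractLeft_ι_mul (Q := (0 : QuadraticForm ℝ W7)) (dualize7 (Pi.single i 1)) (Pi.single j 1) x
  refine this.trans ?_
  congr 2
  simp [dualize7, Pi.single_apply, eq_comm]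

theorem ctr7_ev (i j : Fin 7) :
    ctr7 (Pi.single i 1) (ev j) = algebraMap ℝ _ (if i = j then 1 else 0 : ℝ) := by
  have := CliffordAlgebra.contractLeft_ι (Q := (0 : QuadraticForm ℝ W7)) (dualize7 (Pi.single i 1)) (Pi.single j 1)
  refine this.trans ?_
  congr 2
  simp [dualize7, Pi.single_apply, eq_comm]

theorem mono_ne (i j k l m : Fin 7) (hij : i < j) (hjk : j < k) (hkl : k < l) (hlm : l < m) (r : ℝ)
    (h : r • (ev i * (ev j * (ev k * (ev l * ev m)))) = 0) : r = 0 := by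
  have h1 := congrArg (fun x => ctr7 (Pi.single m 1) (ctr7 (Pi.single l 1) (ctr7 (Pi.single k 1) (ctr7 (Pi.single j 1) (ctr7 (Pi.single i 1) x))))) h
  have a1 := hij.ne
  have a2 := (hij.trans hjk).ne
  have a3 := (hij.trans (hjk.trans hkl)).ne
  have a4 := (hij.trans (hjk.trans (hkl.trans hlm))).ne
  have b1 := hjk.ne
  have b2 := (hjk.trans hkl).ne
  have b3 := (hjk.trans (hkl.trans hlm)).ne
  have c1 := hkl.ne
  have c2 := (hkl.trans hlm).ne
  have d1 := hlm.ne
  simpa [ctr7_ev_mul, ctr7_ev, a1, a2, a3, a4, b1, b2, b3, c1, c2, d1] using h1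

set_option maxHeartbeats 4000000 in
theorem phi_proj (c : Fin 7 → Fin 7 → Fin 7 → Fin 7 → ℝ) (h : c 2 3 4 5 = 0) (h1 : c 2 3 4 6 = 0)
   (h2 : c 2 3 5 6 = 0) (h3 : c 2 4 5 6 = 0) (h4 : c 3 4 5 6 = 0) :
   ExteriorAlgebra.map (proj {0,1}) (phi4 c) = 0 := by
  unfold phi4
  simp only [map_sum]
  refine Finset.sum_eq_zero fun i _ => Finset.sum_eq_zero fun j _ => Finset.sum_eq_zero fun k _ => Finset.sum_eq_zero fun l _ => ?_
  split_ifs with hh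
  swap
  · simp
  obtain ⟨hij, hjk, hkl⟩ := hh
  simp only [map_smul, map_mul, map_proj_ev]
  by_cases hi : i ∈ ({0,1} : Finset (Fin 7))
  · simp [hi]
  have : (i = 2 ∧ j = 3 ∧ k = 4 ∧ l = 5) ∨ (i = 2 ∧ j = 3 ∧ k = 4 ∧ l = 6) ∨ (i = 2 ∧ j = 3 ∧ k = 5 ∧ l = 6)
    ∨ (i = 2 ∧ j = 4 ∧ k = 5 ∧ l = 6) ∨ (i = 3 ∧ j = 4 ∧ k = 5 ∧ l = 6) := by
    simp at hi; omega
  rcases this with ⟨rfl, rfl, rfl, rfl⟩ | ⟨rfl, rfl, rfl, rfl⟩ | ⟨rfl, rfl, rfl, rfl⟩ | ⟨rfl, rfl, rfl, rfl⟩ | ⟨rfl, rfl, rfl, rfl⟩ <;> simp [h, h1, h2, h3, h4]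

set_option maxHeartbeats 4000000 in
theorem fsum {A : Type*} [AddCommMonoid A] (f : Fin 7 → Fin 7 → Fin 7 → Fin 7 → A) :
   (∑ i : Fin 7, ∑ j : Fin 7, ∑ k : Fin 7, ∑ l : Fin 7,
    if i < j ∧ j < k ∧ k < l then f i j k l else 0) = 
    
    f 0 1 2 3 +
    f 0 1 2 4 +
    f 0 1 2 5 +
    f 0 1 2 6 +
    f 0 1 3 4 +
    f 0 1 3 5 +
    f 0 1 3 6 +
    f 0 1 4 5 +
    f 0 1 4 6 +
    f 0 1 5 6 +
    f 0 2 3 4 +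
    f 0 2 3 5 +
    f 0 2 3 6 +
    f 0 2 4 5 +
    f 0 2 4 6 +
    f 0 2 5 6 +
    f 0 3 4 5 +
    f 0 3 4 6 +
    f 0 3 5 6 +
    f 0 4 5 6 +
    f 1 2 3 4 +
    f 1 2 3 5 +
    f 1 2 3 6 +
    f 1 2 4 5 +
    f 1 2 4 6 +
    f 1 2 5 6 +
    f 1 3 4 5 +
    f 1 3 4 6 +
    f 1 3 5 6 +
    f 1 4 5 6 +
    f 2 3 4 5 +
    f 2 3 4 6 +
    f 2 3 5 6 +
    f 2 4 5 6 +
    f 3 4 5 6 := by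
  simp only [Fin.sum_univ_seven]
  simp only [Fin.isValue, Fin.reduceLT, and_true, and_false, if_true, if_false, add_zero, zero_add]
  simp only [add_assoc]


set_option maxHeartbeats 4000000 in
theorem co2345 (c : Fin 7 → Fin 7 → Fin 7 → Fin 7 → ℝ) (h : dPhi4 c = 0) : c 2 3 4 5 = 0 := by
  have h1 := congrArg (ExteriorAlgebra.map (proj {3, 6})) h
  unfold dPhi4 at h1
  rw [fsum] at h1
  simp [d1, map_proj_ev, mul_assoc, ev_sq, ev_sq', mul_add, mul_sub,
    ev_swap, ev_swap', -smul_eq_zero] at h1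
  exact mono_ne 0 1 2 4 5 (by decide) (by decide) (by decide) (by decide) _ h1

set_option maxHeartbeats 4000000 in
theorem co0456 (c : Fin 7 → Fin 7 → Fin 7 → Fin 7 → ℝ) (h : dPhi4 c = 0) : c 0 4 5 6 = 0 := by
  have h1 := congrArg (ExteriorAlgebra.map (proj {2, 4})) h
  unfold dPhi4 at h1
  rw [fsum] at h1
  simp [d1, map_proj_ev, mul_assoc, ev_sq, ev_sq', mul_add, mul_sub,
    ev_swap, ev_swap', -smul_eq_zero] at h1
  exact mono_ne 0 1 3 5 6 (by decide) (by decide) (by decide) (by decide) _ h1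

set_option maxHeartbeats 4000000 in
theorem co1456 (c : Fin 7 → Fin 7 → Fin 7 → Fin 7 → ℝ) (h : dPhi4 c = 0) : c 1 4 5 6 = 0 := by
  have h1 := congrArg (ExteriorAlgebra.map (proj {2, 5})) h
  unfold dPhi4 at h1
  rw [fsum] at h1
  simp [d1, map_proj_ev, mul_assoc, ev_sq, ev_sq', mul_add, mul_sub,
    ev_swap, ev_swap', -smul_eq_zero] at h1
  exact mono_ne 0 1 3 4 6 (by decide) (by decide) (by decide) (by decide) _ h1

set_option maxHeartbeats 4000000 in
theorem co2346 (c : Fin 7 → Fin 7 → Fin 7 → Fin 7 → ℝ) (h : dPhi4 c = 0) (h0 : c 0 4 5 6 = 0) : c 2 3 4 6 = 0 := by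
  have h1 := congrArg (ExteriorAlgebra.map (proj {3, 5})) h
  unfold dPhi4 at h1
  rw [fsum] at h1
  simp [d1, map_proj_ev, mul_assoc, ev_sq, ev_sq', mul_add, mul_sub,
    ev_swap, ev_swap', h0, -smul_eq_zero] at h1
  exact mono_ne 0 1 2 4 6 (by decide) (by decide) (by decide) (by decide) _ h1

set_option maxHeartbeats 4000000 in
theorem co2356 (c : Fin 7 → Fin 7 → Fin 7 → Fin 7 → ℝ) (h : dPhi4 c = 0) (h0 : c 1 4 5 6 = 0) : c 2 3 5 6 = 0 := by
  have h1 := congrArg (ExteriorAlgebra.map (proj {3, 4})) h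
  unfold dPhi4 at h1
  rw [fsum] at h1
  simp [d1, map_proj_ev, mul_assoc, ev_sq, ev_sq', mul_add, mul_sub,
    ev_swap, ev_swap', h0, -smul_eq_zero] at h1
  exact mono_ne 0 1 2 5 6 (by decide) (by decide) (by decide) (by decide) _ h1

set_option maxHeartbeats 4000000 in
theorem co2456 (c : Fin 7 → Fin 7 → Fin 7 → Fin 7 → ℝ) (h : dPhi4 c = 0) : c 2 4 5 6 = 0 := by
  have h1 := congrArg (ExteriorAlgebra.map (proj {0, 4})) h
  unfold dPhi4 at h1
  rw [fsum] at h1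
  simp [d1, map_proj_ev, mul_assoc, ev_sq, ev_sq', mul_add, mul_sub,
    ev_swap, ev_swap', -smul_eq_zero] at h1
  exact mono_ne 1 2 3 5 6 (by decide) (by decide) (by decide) (by decide) _ h1

set_option maxHeartbeats 4000000 in
theorem co3456 (c : Fin 7 → Fin 7 → Fin 7 → Fin 7 → ℝ) (h : dPhi4 c = 0) : c 3 4 5 6 = 0 := by
  have h1 := congrArg (ExteriorAlgebra.map (proj {1, 4})) h
  unfold dPhi4 at h1
  rw [fsum] at h1
  simp [d1, map_proj_ev, mul_assoc, ev_sq, ev_sq', mul_add, mul_sub,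
    ev_swap, ev_swap', -smul_eq_zero] at h1
  exact mono_ne 0 2 3 5 6 (by decide) (by decide) (by decide) (by decide) _ h1

theorem ev_mem (i : Fin 7) : ev i ∈ LinearMap.range (ExteriorAlgebra.ι ℝ (M := W7)) := ⟨_, rfl⟩

theorem phi4_mem (c : Fin 7 → Fin 7 → Fin 7 → Fin 7 → ℝ) :
    phi4 c ∈ (LinearMap.range (ExteriorAlgebra.ι ℝ (M := W7))) ^ 4 := by
  unfold phi4
  refine Submodule.sum_mem _ fun i _ => Submodule.sum_mem _ fun j _ =>
    Submodule.sum_mem _ fun k _ => Submodule.sum_mem _ fun l _ => ?_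
  split_ifs
  · refine Submodule.smul_mem _ _ ?_
    rw [pow_succ, pow_succ, pow_succ, pow_one]
    exact Submodule.mul_mem_mul (Submodule.mul_mem_mul (Submodule.mul_mem_mul
      (ev_mem i) (ev_mem j)) (ev_mem k)) (ev_mem l)
  · exact Submodule.zero_mem _

/-- Contraction by a vector of `W ⊕ ℝe₇` commutes with restriction. -/
theorem proj_ctr7 (w : W7) (h0 : w 0 = 0) (h1 : w 1 = 0) (x : ExteriorAlgebra ℝ W7) :
    ctr7 w (ExteriorAlgebra.map (proj {0, 1}) x) = ExteriorAlgebra.map (proj {0, 1}) (ctr7 w x) := by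
  have h : dualize7 w ∘ₗ proj {0, 1} = dualize7 w := by
    ext i
    fin_cases i <;> simp [dualize7, proj, Fin.sum_univ_succ, h0, h1]
  unfold ctr7
  erw [map_contract, h]

def ext0 (w : W6) : W7 := Fin.snoc w 0

theorem piStar_ctr (w : W6) (x : ExteriorAlgebra ℝ W6) :
    piStar (ctr6 w x) = ctr7 (ext0 w) (piStar x) := by
  unfold ctr7 ctr6 piStar
  erw [map_contract]
  congr 3
  ext i
  fin_cases i <;> simp [dualize7, dualize6, ext0, Fin.sum_univ_succ, Fin.snoc] <;> rfl

theorem piStar_inj : Function.Injective piStar := by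
  unfold piStar
  apply ExteriorAlgebra.map_injective_field
  rw [LinearMap.ker_eq_bot]
  intro x y h
  ext i
  have := congrFun h i.castSucc
  simpa [Matrix.mulVec, dotProduct, Fin.val_inj] using this

theorem sigma_vanishes_on_W
    (c : Fin 7 → Fin 7 → Fin 7 → Fin 7 → ℝ) (hclosed : dPhi4 c = 0) :
    c 2 3 4 5 = 0 ∧
    ∀ (a : Fin 7 → ℝ), a 6 ≠ 0 →
      ∀ ψ σ : ExteriorAlgebra ℝ W6,
        piStar ψ = -ctr7 (Pi.single 6 1) (phi4 c) →
        piStar σ = phi4 c - piStar ψ * (∑ i : Fin 7, a i • ev i) →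
        ∀ w₁ w₂ w₃ w₄ : W6,
          w₁ 0 = 0 → w₁ 1 = 0 → w₂ 0 = 0 → w₂ 1 = 0 →
          w₃ 0 = 0 → w₃ 1 = 0 → w₄ 0 = 0 → w₄ 1 = 0 →
          ctr6 w₄ (ctr6 w₃ (ctr6 w₂ (ctr6 w₁ σ))) = 0 := by
  have h1 := co2345 c hclosed
  refine ⟨h1, ?_⟩
  intro a _ ψ σ hψ hσ w₁ w₂ w₃ w₄ h10 h11 h20 h21 h30 h31 h40 h41
  have hφ : ExteriorAlgebra.map (proj {0, 1}) (phi4 c) = 0 :=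
    phi_proj c h1 (co2346 c hclosed (co0456 c hclosed)) (co2356 c hclosed (co1456 c hclosed))
      (co2456 c hclosed) (co3456 c hclosed)
  have hτ : ExteriorAlgebra.map (proj {0, 1}) (piStar σ) = 0 := by
    rw [hσ, hψ, map_sub, map_mul, map_neg, ← proj_ctr7 _ (by simp) (by simp), hφ]
    simp
  have hmem : piStar σ ∈ (LinearMap.range (ExteriorAlgebra.ι ℝ (M := W7))) ^ 4 := by
    rw [hσ, hψ]
    refine Submodule.sub_mem _ (phi4_mem c) ?_
    rw [pow_succ]
    exact Submodule.mul_mem_mul (Submodule.neg_mem _ (contract_pow _ 3 _ (phi4_mem c)))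
      (Submodule.sum_mem _ fun i _ => Submodule.smul_mem _ _ (ev_mem i))
  apply piStar_inj
  rw [map_zero, piStar_ctr, piStar_ctr, piStar_ctr, piStar_ctr]
  have hs := contract_pow (dualize7 (ext0 w₄)) 0 _ (contract_pow (dualize7 (ext0 w₃)) 1 _
    (contract_pow (dualize7 (ext0 w₂)) 2 _ (contract_pow (dualize7 (ext0 w₁)) 3 _ hmem)))
  rw [pow_zero, Submodule.mem_one] at hs
  obtain ⟨r, hr⟩ := hs
  replace hr : algebraMap ℝ (ExteriorAlgebra ℝ W7) r =
    ctr7 (ext0 w₄) (ctr7 (ext0 w₃) (ctr7 (ext0 w₂) (ctr7 (ext0 w₁) (piStar σ)))) := hr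
  have hr2 := congrArg (ExteriorAlgebra.map (proj {0, 1})) hr
  rw [← proj_ctr7 _ h40 h41, ← proj_ctr7 _ h30 h31, ← proj_ctr7 _ h20 h21,
    ← proj_ctr7 _ h10 h11, hτ, AlgHom.commutes] at hr2
  rw [← hr, hr2]
  simp

end
end

section
/- Let 𝔤 = (0,0,0,12,13−24,23+14,0) and let φ be any closed 4-form on 𝔤 with ψ₋ = π_*(−ι_{e₇}φ) ∈ Λ₋(𝔥) (the orbit of 3-forms with λ < 0). Then for any choice of volume form on 𝔥 = 𝔤/ℝe₇, the induced almost complex structure J_{ψ₋} = K_{ψ₋}/√|λ(ψ₋)| leaves the subspace W = Span(f₃,f₄,f₅,f₆) invariant. -/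
/- STATEMENT 15: Let 𝔤 = (0,0,0,12,13−24,23+14,0) and φ a closed 4-form with
ψ₋ = π_*(−ι_{e₇}φ) ∈ Λ₋(𝔥) (i.e. λ(ψ₋) < 0).  Then for any choice of volume form
t·vol₆ (t ≠ 0) on 𝔥 = 𝔤/ℝe₇, the almost complex structure J = K/√|λ| (where
ι_xψ₋∧ψ₋ = ι_{Kx}(t·vol₆) and λ = (1/6)trace(K²)) leaves W = Span(f₃,f₄,f₅,f₆)
invariant.  (0-based indices; W = {w | w₀ = w₁ = 0}.) -/

noncomputable section

open ExteriorAlgebra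

def fv (i : Fin 6) : ExteriorAlgebra ℝ W6 := ExteriorAlgebra.ι ℝ (Pi.single i 1)

def vol6 : ExteriorAlgebra ℝ W6 := fv 0 * fv 1 * fv 2 * fv 3 * fv 4 * fv 5

theorem sum_expand {M : Type} [AddCommMonoid M] (F : Fin 7 → Fin 7 → Fin 7 → Fin 7 → M) :
    (∑ i : Fin 7, ∑ j : Fin 7, ∑ k : Fin 7, ∑ l : Fin 7,
      if i < j ∧ j < k ∧ k < l then F i j k l else 0) =
    F 0 1 2 3 + F 0 1 2 4 + F 0 1 2 5 + F 0 1 2 6 + F 0 1 3 4 + F 0 1 3 5 + F 0 1 3 6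
    + F 0 1 4 5 + F 0 1 4 6 + F 0 1 5 6 + F 0 2 3 4 + F 0 2 3 5 + F 0 2 3 6 + F 0 2 4 5
    + F 0 2 4 6 + F 0 2 5 6 + F 0 3 4 5 + F 0 3 4 6 + F 0 3 5 6 + F 0 4 5 6 + F 1 2 3 4
    + F 1 2 3 5 + F 1 2 3 6 + F 1 2 4 5 + F 1 2 4 6 + F 1 2 5 6 + F 1 3 4 5 + F 1 3 4 6
    + F 1 3 5 6 + F 1 4 5 6 + F 2 3 4 5 + F 2 3 4 6 + F 2 3 5 6 + F 2 4 5 6 + F 3 4 5 6 := by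
  simp [Fin.sum_univ_seven, ite_and, add_assoc]

/-- contraction with the basis vector `e_i` -/
def C (i : Fin 7) : ExteriorAlgebra ℝ W7 →ₗ[ℝ] ExteriorAlgebra ℝ W7 :=
  CliffordAlgebra.contractLeft (LinearMap.proj i)

theorem C_mul (i j : Fin 7) (b : ExteriorAlgebra ℝ W7) :
    C i (ev j * b) = (if i = j then (1:ℝ) else 0) • b - ev j * C i b := by
  have := CliffordAlgebra.contractLeft_ι_mul (Q := (0 : QuadraticForm ℝ W7))
    (d := LinearMap.proj i) (Pi.single j 1) b
  simp only [LinearMap.proj_apply, Pi.single_apply] at this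
  exact this

theorem C_ev (i j : Fin 7) :
    C i (ev j) = (if i = j then (1:ℝ) else 0) • 1 := by
  have := C_mul i j 1
  have h1 : C i 1 = 0 := CliffordAlgebra.contractLeft_one (Q := 0) _
  rw [h1, mul_one, mul_zero, sub_zero] at this
  exact this

set_option maxHeartbeats 4000000 in
theorem coeffs (c : Fin 7 → Fin 7 → Fin 7 → Fin 7 → ℝ) (h : dPhi4 c = 0) :
    c 2 3 4 6 = 0 ∧ c 2 3 5 6 = 0 ∧ c 2 4 5 6 = 0 ∧ c 3 4 5 6 = 0 := by
  unfold dPhi4 at h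
  rw [sum_expand] at h
  simp only [d1, Matrix.cons_val, mul_zero, zero_mul, sub_zero, add_zero, zero_add, zero_sub,
    smul_zero, sub_self, mul_add, mul_sub, add_mul, sub_mul, mul_assoc] at h
  have h6 := congrArg (fun z => C 6 z) h
  simp only [map_add, map_sub, map_neg, map_smul, map_zero] at h6
  simp [C_mul, C_ev] at h6
  have h5 := congrArg (fun z => C 5 z) h6
  have h4 := congrArg (fun z => C 4 z) h6
  clear h h6
  simp [C_mul, C_ev] at h5 h4
  have e1 := congrArg (fun z => C 0 (C 1 (C 4 z))) h5
  have e2 := congrArg (fun z => C 1 (C 2 (C 3 z))) h5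
  have e3 := congrArg (fun z => C 0 (C 1 (C 2 z))) h4
  have e4 := congrArg (fun z => C 0 (C 1 (C 3 z))) h5
  have e5 := congrArg (fun z => C 0 (C 1 (C 2 z))) h5
  have e6 := congrArg (fun z => C 0 (C 1 (C 3 z))) h4
  clear h4 h5
  simp [C_mul, C_ev] at e1 e2 e3 e4 e5 e6
  rw [e4] at e3
  rw [e6] at e5
  simp at e3 e5
  exact ⟨e3, e5, e2, e1⟩

theorem ctr6_mul (x : W6) (j : Fin 6) (b : ExteriorAlgebra ℝ W6) :
    ctr6 x (fv j * b) = x j • b - fv j * ctr6 x b := by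
  have := CliffordAlgebra.contractLeft_ι_mul (Q := (0 : QuadraticForm ℝ W6))
    (d := dualize6 x) (Pi.single j 1) b
  have h : dualize6 x (Pi.single j 1) = x j := by
    simp [dualize6, Pi.single_apply]
  rw [h] at this
  exact this

theorem ctr6_fv (x : W6) (j : Fin 6) : ctr6 x (fv j) = x j • 1 := by
  have := ctr6_mul x j 1
  have h1 : ctr6 x 1 = 0 := CliffordAlgebra.contractLeft_one (Q := 0) _
  rw [h1, mul_one, mul_zero, sub_zero] at this
  exact this

theorem fv_sq (i : Fin 6) : fv i * fv i = 0 := ExteriorAlgebra.ι_sq_zero _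

theorem fv_swap (i j : Fin 6) : fv i * fv j = - (fv j * fv i) :=
  eq_neg_of_add_eq_zero_left (ExteriorAlgebra.ι_add_mul_swap _ _)

theorem fv_comm (i : Fin 6) (b : ExteriorAlgebra ℝ W6) :
    ∃ b', b * fv i = fv i * b' := by
  induction b using ExteriorAlgebra.induction with
  | algebraMap r => exact ⟨_, Algebra.commutes _ _⟩
  | ι m =>
    refine ⟨-ExteriorAlgebra.ι ℝ m, ?_⟩
    rw [mul_neg]
    exact eq_neg_of_add_eq_zero_left (ExteriorAlgebra.ι_add_mul_swap _ _)
  | mul a b ha hb =>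
    obtain ⟨a', ha⟩ := ha
    obtain ⟨b', hb⟩ := hb
    exact ⟨a' * b', by rw [mul_assoc, hb, ← mul_assoc, ha, mul_assoc]⟩
  | add a b ha hb =>
    obtain ⟨a', ha⟩ := ha
    obtain ⟨b', hb⟩ := hb
    exact ⟨a' + b', by rw [add_mul, ha, hb, mul_add]⟩

theorem vol6_ne : vol6 ≠ 0 := by
  intro h
  have := congrArg (fun z => ctr6 (Pi.single 5 1) (ctr6 (Pi.single 4 1) (ctr6 (Pi.single 3 1)
    (ctr6 (Pi.single 2 1) (ctr6 (Pi.single 1 1) (ctr6 (Pi.single 0 1) z)))))) h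
  simp [vol6, mul_assoc, ctr6_mul, ctr6_fv] at this

theorem fv_vol (j : Fin 6) : fv j * vol6 = 0 := by
  have key : ∀ (a : Fin 6) (b : ExteriorAlgebra ℝ W6), fv a * (fv a * b) = 0 := by
    intro a b; rw [← mul_assoc, fv_sq, zero_mul]
  have sw : ∀ (a a' : Fin 6) (b : ExteriorAlgebra ℝ W6),
      fv a * (fv a' * b) = - (fv a' * (fv a * b)) := by
    intro a a' b; rw [← mul_assoc, fv_swap, neg_mul, mul_assoc]
  unfold vol6
  simp only [mul_assoc]
  fin_cases j <;> simp only [Fin.zero_eta, Fin.mk_one, Fin.reduceFinMk]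
  · exact key _ _
  · rw [sw 1 0, key]; simp
  · rw [sw 2 0, sw 2 1, key]; simp
  · rw [sw 3 0, sw 3 1, sw 3 2, key]; simp
  · rw [sw 4 0, sw 4 1, sw 4 2, sw 4 3, key]; simp
  · rw [sw 5 0, sw 5 1, sw 5 2, sw 5 3, sw 5 4, fv_sq]; simp

theorem fv_ctr_vol (j : Fin 6) (y : W6) : fv j * ctr6 y vol6 = y j • vol6 := by
  have := ctr6_mul y j vol6
  rw [fv_vol, map_zero] at this
  exact (sub_eq_zero.mp this.symm).symm

/-- left inverse of the pullback -/
def qmap : ExteriorAlgebra ℝ W7 →ₐ[ℝ] ExteriorAlgebra ℝ W6 :=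
  ExteriorAlgebra.map (LinearMap.funLeft ℝ ℝ (Fin.castSucc : Fin 6 → Fin 7))

theorem qmap_piStar (ψ : ExteriorAlgebra ℝ W6) : qmap (piStar ψ) = ψ := by
  have h : (LinearMap.funLeft ℝ ℝ (Fin.castSucc : Fin 6 → Fin 7)) ∘ₗ
      (Matrix.toLin' (Matrix.of fun (i : Fin 7) (j : Fin 6) =>
      if (i : ℕ) = (j : ℕ) then (1:ℝ) else 0)) = LinearMap.id := by
    apply LinearMap.ext
    intro x
    funext i
    simp [LinearMap.funLeft_apply, Matrix.mulVec, dotProduct, Fin.val_inj]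
  have h2 : qmap.comp piStar = AlgHom.id ℝ _ := by
    unfold qmap piStar
    rw [ExteriorAlgebra.map_comp_map, h, ExteriorAlgebra.map_id]
  exact DFunLike.congr_fun h2 ψ

theorem qmap_ev (i : Fin 6) : qmap (ev i.castSucc) = fv i := by
  unfold qmap ev fv
  rw [ExteriorAlgebra.map_apply_ι]
  congr 1
  funext j
  simp [LinearMap.funLeft_apply, Pi.single_apply]

theorem ctr7_eq : ctr7 (Pi.single 6 1) = C 6 := by
  unfold ctr7 C
  congr 1
  simp [dualize7, Pi.single_apply]

set_option maxHeartbeats 1000000 in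
theorem psi_form (c : Fin 7 → Fin 7 → Fin 7 → Fin 7 → ℝ) (h : dPhi4 c = 0)
    (ψ : ExteriorAlgebra ℝ W6)
    (hψ : piStar ψ = -ctr7 (Pi.single 6 1) (phi4 c)) :
    ∃ A B, ψ = fv 0 * A + fv 1 * B := by
  obtain ⟨h1, h2, h3, h4⟩ := coeffs c h
  have e := congrArg qmap hψ
  rw [qmap_piStar, ctr7_eq] at e
  have h0 : qmap (ev 0) = fv 0 := qmap_ev 0
  have h1' : qmap (ev 1) = fv 1 := qmap_ev 1
  let S : Submodule ℝ (ExteriorAlgebra ℝ W6) :=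
    LinearMap.range (LinearMap.mulLeft ℝ (fv 0)) ⊔ LinearMap.range (LinearMap.mulLeft ℝ (fv 1))
  have m0 : ∀ b, qmap (C 6 (ev 0 * b)) ∈ S := by
    intro b
    rw [C_mul]
    refine Submodule.mem_sup_left ⟨-qmap (C 6 b), ?_⟩
    simp [h0]
  have m1 : ∀ b, qmap (C 6 (ev 1 * b)) ∈ S := by
    intro b
    rw [C_mul]
    refine Submodule.mem_sup_right ⟨-qmap (C 6 b), ?_⟩
    simp [h1']
  have m2 : C 6 (ev 2 * (ev 3 * (ev 4 * ev 5))) = 0 := by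
    simp [C_mul, C_ev]
  have hS : ψ ∈ S := by
    rw [e]
    unfold phi4
    rw [sum_expand]
    simp only [mul_assoc, map_add, map_smul, map_neg, h1, h2, h3, h4, zero_smul, m2,
      smul_zero, add_zero]
    apply S.neg_mem
    repeat' with_reducible refine S.add_mem ?_ ?_
    all_goals with_reducible refine S.smul_mem _ ?_
    all_goals first | with_reducible exact m0 _ | with_reducible exact m1 _
  obtain ⟨a, ⟨A, rfl⟩, b, ⟨B, rfl⟩, hab⟩ := Submodule.mem_sup.mp hS
  exact ⟨A, B, hab.symm⟩

theorem kill (i j : Fin 6) (A B A' B' : ExteriorAlgebra ℝ W6) :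
    fv i * ((fv i * A' + fv j * B') * (fv i * A + fv j * B)) = 0 := by
  have key : ∀ (a : Fin 6) (b : ExteriorAlgebra ℝ W6), fv a * (fv a * b) = 0 := by
    intro a b; rw [← mul_assoc, fv_sq, zero_mul]
  have sw : ∀ (a a' : Fin 6) (b : ExteriorAlgebra ℝ W6),
      fv a * (fv a' * b) = - (fv a' * (fv a * b)) := by
    intro a a' b; rw [← mul_assoc, fv_swap, neg_mul, mul_assoc]
  obtain ⟨D, hD⟩ := fv_comm i B'
  obtain ⟨E, hE⟩ := fv_comm j B'
  simp only [add_mul, mul_add, mul_assoc, key, zero_add]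
  rw [← mul_assoc B', ← mul_assoc B', hD, hE]
  simp only [mul_assoc, key, mul_zero, add_zero]
  rw [sw j i, mul_neg, key, neg_zero]

theorem J_leaves_W_invariant
    (c : Fin 7 → Fin 7 → Fin 7 → Fin 7 → ℝ) (hclosed : dPhi4 c = 0)
    (ψ : ExteriorAlgebra ℝ W6)
    (hψ : piStar ψ = -ctr7 (Pi.single 6 1) (phi4 c))
    (t : ℝ) (ht : t ≠ 0)
    (K : Matrix (Fin 6) (Fin 6) ℝ)
    (hK : ∀ x : Fin 6 → ℝ, ctr6 x ψ * ψ = ctr6 (K.mulVec x) (t • vol6))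
    (hneg : (6:ℝ)⁻¹ * (K * K).trace < 0) :
    ∀ x : W6, x 0 = 0 → x 1 = 0 →
      (((Real.sqrt |(6:ℝ)⁻¹ * (K * K).trace|)⁻¹ • K).mulVec x) 0 = 0 ∧
      (((Real.sqrt |(6:ℝ)⁻¹ * (K * K).trace|)⁻¹ • K).mulVec x) 1 = 0 := by
  intro x hx0 hx1
  obtain ⟨A, B, rfl⟩ := psi_form c hclosed ψ hψ
  have h := hK x
  have hc : ctr6 x (fv 0 * A + fv 1 * B) = fv 0 * (-ctr6 x A) + fv 1 * (-ctr6 x B) := by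
    rw [map_add, ctr6_mul, ctr6_mul, hx0, hx1]
    simp
  rw [hc, map_smul] at h
  have k0 : K.mulVec x 0 = 0 := by
    have := congrArg (fun z => fv 0 * z) h
    simp only [kill, mul_smul_comm, fv_ctr_vol] at this
    simpa [ht, vol6_ne] using this.symm
  have k1 : K.mulVec x 1 = 0 := by
    have := congrArg (fun z => fv 1 * z) h
    rw [add_comm (fv 0 * _), add_comm (fv 0 * _)] at this
    simp only [kill, mul_smul_comm, fv_ctr_vol] at this
    simpa [ht, vol6_ne] using this.symm
  simp [Matrix.smul_mulVec, k0, k1]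

end
end
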